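/- Let A be the companion matrix of f(x) = (x-1)³(x²−x+1) and B the companion matrix of g(x) = (x+1)(x⁴+x³+x²+x+1), and set T = B·A⁻¹ in GL(5,ℚ). Then T² = I with T ≠ I, B has order 10 and no power of B equals −I, and the hypergeometric group Γ(f,g) = ⟨A,B⟩ is the free product of the subgroup generated by T and the subgroup generated by B: the canonical group homomorphism from the abstract free product (ℤ/2ℤ) ∗ (ℤ/10ℤ) to GL(5,ℚ) sending the generator of ℤ/2ℤ to T and the generator of ℤ/10ℤ to B is injective with image Γ(f,g). -/

import Mathlib

open Polynomial Matrix

/-- The companion matrix of a monic degree-5 rational polynomial `p`: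
the `5 × 5` matrix whose entries in position `(i+1, i)` equal `1` for
`i = 1, ..., 4`, whose last column is `(-p₀, -p₁, -p₂, -p₃, -p₄)ᵀ`
(where `pᵢ` is the coefficient of `xⁱ` in `p`), and whose remaining
entries are `0`. -/
def companionMatrix (p : ℚ[X]) : Matrix (Fin 5) (Fin 5) ℚ :=
  Matrix.of fun i j : Fin 5 =>
    if (j : ℕ) = 4 then -p.coeff i
    else if (i : ℕ) = (j : ℕ) + 1 then 1 else 0

/-- The homomorphism `ℤ/n → G` sending the generator to an element `g` with `g ^ n = 1`. -/
def zmodPowHom {G : Type*} [Group G] (n : ℕ) (g : G) (hg : g ^ n = 1) :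
    Multiplicative (ZMod n) →* G :=
  AddMonoidHom.toMultiplicativeLeft
    (ZMod.lift n ⟨zmultiplesHom (Additive G) (Additive.ofMul g), by
      simp [← ofMul_pow, hg]⟩)

theorem zmodPowHom_intCast {G : Type*} [Group G] (n : ℕ) (g : G) (hg : g ^ n = 1) (k : ℤ) :
    zmodPowHom n g hg (Multiplicative.ofAdd (k : ZMod n)) = g ^ k := by
  simp [zmodPowHom, ZMod.lift_coe]

theorem zmodPowHom_one {G : Type*} [Group G] (n : ℕ) (g : G) (hg : g ^ n = 1) :
    zmodPowHom n g hg (Multiplicative.ofAdd 1) = g := by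
  simpa using zmodPowHom_intCast n g hg 1

theorem zmodPowHom_natCast {G : Type*} [Group G] (n : ℕ) (g : G) (hg : g ^ n = 1) (k : ℕ) :
    zmodPowHom n g hg (Multiplicative.ofAdd (k : ZMod n)) = g ^ k := by
  simpa using zmodPowHom_intCast n g hg k

theorem zmodPowHom_range {G : Type*} [Group G] (n : ℕ) (g : G) (hg : g ^ n = 1) :
    (zmodPowHom n g hg).range = Subgroup.zpowers g := by
  ext y
  constructor
  · rintro ⟨x, rfl⟩
    obtain ⟨k, hk⟩ := ZMod.intCast_surjective x.toAdd
    exact ⟨k, by simp [← zmodPowHom_intCast n g hg, hk]⟩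
  · rintro ⟨k, rfl⟩
    exact ⟨_, zmodPowHom_intCast n g hg k⟩

/-- An element `x ≠ 1` of the cyclic group of order `n` acts as `g ^ k` with `0 < k < n`. -/
theorem exists_zmodPowHom_eq_pow {G : Type*} [Group G] (n : ℕ) [NeZero n] (g : G) (hg : g ^ n = 1)
    {x : Multiplicative (ZMod n)} (hx : x ≠ 1) :
    ∃ k : ℕ, 0 < k ∧ k < n ∧ zmodPowHom n g hg x = g ^ k := by
  refine ⟨x.toAdd.val, Nat.pos_of_ne_zero fun h => hx ?_, ZMod.val_lt _, ?_⟩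
  · exact (ZMod.val_eq_zero _).mp h
  · rw [← zmodPowHom_natCast n g hg, ZMod.natCast_zmod_val, ofAdd_toAdd]

open scoped Pointwise in
/-- The ping-pong lemma for two factors, phrased with the ping-pong set of the first factor. -/
theorem Monoid.Coprod.lift_injective_of_ping_pong {M N : Type} {G α : Type*} [Group M] [Group N]
    [Group G] [MulAction G α] (f : M →* G) (g : N →* G) (X : Set α) (hX : X.Nonempty)
    (hN : 3 ≤ Cardinal.mk N)
    (hdisj : ∀ n : N, n ≠ 1 → Disjoint X (g n • X))
    (hmaps : ∀ m : M, m ≠ 1 → ∀ n : N, n ≠ 1 → f m • g n • X ⊆ X) :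
    Function.Injective (Monoid.Coprod.lift f g) := by
  let H : Bool → Type := fun b => cond b N M
  let : ∀ b, Group (H b) := fun b => by cases b <;> simp only [H, cond] <;> infer_instance
  let F : ∀ b, H b →* G := fun b => match b with
    | false => f
    | true => g
  let Z : Bool → Set α := fun b => cond b (⋃ n : {n : N // n ≠ 1}, g n • X) X
  obtain ⟨n₀, hn₀⟩ : ∃ n : N, n ≠ 1 := by
    by_contra! h
    have : Subsingleton N := ⟨fun a b => (h a).trans (h b).symm⟩
    have : Cardinal.mk N ≤ 1 := Cardinal.le_one_iff_subsingleton.mpr this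
    exact absurd (hN.trans this) (by norm_num)
  have hlift : Function.Injective (Monoid.CoprodI.lift F) := by
    refine Monoid.CoprodI.lift_injective_of_ping_pong F (Or.inr ⟨true, hN⟩) Z ?_ ?_ ?_
    · rintro (_ | _)
      · exact hX
      · exact (hX.smul_set (a := g n₀)).mono (Set.subset_iUnion_of_subset ⟨n₀, hn₀⟩ subset_rfl)
    · have key : Disjoint (Z false) (Z true) :=
        Set.disjoint_iUnion_right.mpr fun n => hdisj n n.2
      rintro (_ | _) (_ | _) h
      exacts [absurd rfl h, key, key.symm, absurd rfl h]
    · rintro (_ | _) (_ | _) h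
      · exact absurd rfl h
      · intro m hm
        refine (Set.smul_set_iUnion _ _).trans_subset (Set.iUnion_subset fun n => ?_)
        exact hmaps m hm n n.2
      · intro n hn
        exact Set.subset_iUnion_of_subset (⟨n, hn⟩ : {n : N // n ≠ 1}) subset_rfl
      · exact absurd rfl h
  let ι : Monoid.Coprod M N →* Monoid.CoprodI H :=
    Monoid.Coprod.lift (Monoid.CoprodI.of (M := H) (i := false))
      (Monoid.CoprodI.of (M := H) (i := true))
  let E : ∀ b, H b →* Monoid.Coprod M N := fun b => match b with
    | false => Monoid.Coprod.inl
    | true => Monoid.Coprod.inr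
  have hleft : (Monoid.CoprodI.lift E).comp ι = MonoidHom.id _ :=
    Monoid.Coprod.hom_ext
      (MonoidHom.ext fun m => by simp [ι, Monoid.CoprodI.lift_of, E])
      (MonoidHom.ext fun n => by simp [ι, Monoid.CoprodI.lift_of, E])
  have hcomp : Monoid.Coprod.lift f g = (Monoid.CoprodI.lift F).comp ι :=
    Monoid.Coprod.hom_ext
      (MonoidHom.ext fun m => by simp [ι, Monoid.CoprodI.lift_of, F])
      (MonoidHom.ext fun n => by simp [ι, Monoid.CoprodI.lift_of, F])
  rw [hcomp, MonoidHom.coe_comp]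
  exact hlift.comp (Function.LeftInverse.injective (DFunLike.congr_fun hleft))

/-- The action of `GL n R` on column vectors. -/
abbrev Matrix.GeneralLinearGroup.mulVecAction (n R : Type*) [Fintype n] [DecidableEq n]
    [CommRing R] : MulAction (GL n R) (n → R) where
  smul g v := (g : Matrix n n R) *ᵥ v
  one_smul v := one_mulVec v
  mul_smul g h v := (mulVec_mulVec v (g : Matrix n n R) h).symm

/-- The matrix `B`. -/
def rotMatrix : Matrix (Fin 5) (Fin 5) ℚ :=
  !![0, 0, 0, 0, -1; 1, 0, 0, 0, -2; 0, 1, 0, 0, -2; 0, 0, 1, 0, -2; 0, 0, 0, 1, -2]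

/-- The reflection `T`. -/
def reflMatrix : Matrix (Fin 5) (Fin 5) ℚ :=
  !![-1, 0, 0, 0, 0; 2, 1, 0, 0, 0; -9, 0, 1, 0, 0; 5, 0, 0, 1, 0; -6, 0, 0, 0, 1]

/-- The matrix `A`. -/
def unipMatrix : Matrix (Fin 5) (Fin 5) ℚ :=
  !![0, 0, 0, 0, 1; 1, 0, 0, 0, -4; 0, 1, 0, 0, 7; 0, 0, 1, 0, -7; 0, 0, 0, 1, 4]

theorem rotMatrix_pow_2 : rotMatrix ^ 2 =
    !![0, 0, 0, -1, 2; 0, 0, 0, -2, 3; 1, 0, 0, -2, 2; 0, 1, 0, -2, 2; 0, 0, 1, -2, 2] := by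
  rw [pow_succ, pow_one, rotMatrix]
  ext i j
  fin_cases i <;> fin_cases j <;> simp [mul_apply, Fin.sum_univ_five] <;> norm_num

theorem rotMatrix_pow_3 : rotMatrix ^ 3 =
    !![0, 0, -1, 2, -2; 0, 0, -2, 3, -2; 0, 0, -2, 2, -1; 1, 0, -2, 2, -2; 0, 1, -2, 2, -2] := by
  rw [pow_succ, rotMatrix_pow_2, rotMatrix]
  ext i j
  fin_cases i <;> fin_cases j <;> simp [mul_apply, Fin.sum_univ_five] <;> norm_num

theorem rotMatrix_pow_4 : rotMatrix ^ 4 =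
    !![0, -1, 2, -2, 2; 0, -2, 3, -2, 2; 0, -2, 2, -1, 2; 0, -2, 2, -2, 3; 1, -2, 2, -2, 2] := by
  rw [pow_succ, rotMatrix_pow_3, rotMatrix]
  ext i j
  fin_cases i <;> fin_cases j <;> simp [mul_apply, Fin.sum_univ_five] <;> norm_num

theorem rotMatrix_pow_5 : rotMatrix ^ 5 =
    !![-1, 2, -2, 2, -2; -2, 3, -2, 2, -2; -2, 2, -1, 2, -2; -2, 2, -2, 3, -2; -2, 2, -2, 2, -1] := by
  rw [pow_succ, rotMatrix_pow_4, rotMatrix]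
  ext i j
  fin_cases i <;> fin_cases j <;> simp [mul_apply, Fin.sum_univ_five] <;> norm_num

theorem rotMatrix_pow_6 : rotMatrix ^ 6 =
    !![2, -2, 2, -2, 1; 3, -2, 2, -2, 0; 2, -1, 2, -2, 0; 2, -2, 3, -2, 0; 2, -2, 2, -1, 0] := by
  rw [pow_succ, rotMatrix_pow_5, rotMatrix]
  ext i j
  fin_cases i <;> fin_cases j <;> simp [mul_apply, Fin.sum_univ_five] <;> norm_num

theorem rotMatrix_pow_7 : rotMatrix ^ 7 =
    !![-2, 2, -2, 1, 0; -2, 2, -2, 0, 1; -1, 2, -2, 0, 0; -2, 3, -2, 0, 0; -2, 2, -1, 0, 0] := by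
  rw [pow_succ, rotMatrix_pow_6, rotMatrix]
  ext i j
  fin_cases i <;> fin_cases j <;> simp [mul_apply, Fin.sum_univ_five] <;> norm_num

theorem rotMatrix_pow_8 : rotMatrix ^ 8 =
    !![2, -2, 1, 0, 0; 2, -2, 0, 1, 0; 2, -2, 0, 0, 1; 3, -2, 0, 0, 0; 2, -1, 0, 0, 0] := by
  rw [pow_succ, rotMatrix_pow_7, rotMatrix]
  ext i j
  fin_cases i <;> fin_cases j <;> simp [mul_apply, Fin.sum_univ_five] <;> norm_num

theorem rotMatrix_pow_9 : rotMatrix ^ 9 =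
    !![-2, 1, 0, 0, 0; -2, 0, 1, 0, 0; -2, 0, 0, 1, 0; -2, 0, 0, 0, 1; -1, 0, 0, 0, 0] := by
  rw [pow_succ, rotMatrix_pow_8, rotMatrix]
  ext i j
  fin_cases i <;> fin_cases j <;> simp [mul_apply, Fin.sum_univ_five] <;> norm_num

theorem rotMatrix_pow_10 : rotMatrix ^ 10 = 1 := by
  rw [pow_succ, rotMatrix_pow_9, rotMatrix]
  ext i j
  fin_cases i <;> fin_cases j <;> simp [mul_apply, Fin.sum_univ_five]

theorem reflMatrix_sq : reflMatrix ^ 2 = 1 := by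
  rw [pow_two, reflMatrix]
  ext i j
  fin_cases i <;> fin_cases j <;> simp [mul_apply, Fin.sum_univ_five]

theorem reflMatrix_mul_unipMatrix : reflMatrix * unipMatrix = rotMatrix := by
  rw [reflMatrix, unipMatrix, rotMatrix]
  ext i j
  fin_cases i <;> fin_cases j <;> simp [mul_apply, Fin.sum_univ_five] <;> norm_num

/-- An open polyhedral cone which each `± T B ^ k`, `0 < k < 10`, maps into itself. -/
def InCone (x : Fin 5 → ℚ) : Prop :=
  0 < -x 0 + x 4 ∧
  0 < x 0 - x 1 ∧
  0 < -2 * x 0 - x 2 - x 3 + 3 * x 4 ∧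
  0 < -3 * x 1 + x 2 + x 3 ∧
  0 < 14 * x 0 - 2 * x 2 - 3 * x 3 - 2 * x 4 ∧
  0 < 2 * x 1 + 3 * x 2 + 2 * x 3 ∧
  0 < 2 * x 0 + 3 * x 1 + 2 * x 2 - x 4 ∧
  0 < 10 * x 0 + x 1 - 2 * x 3 - 3 * x 4 ∧
  0 < 3 * x 0 + 2 * x 1 - x 3 ∧
  0 < 5 * x 0 + x 2 - 2 * x 4 ∧
  0 < 2 * x 0 - x 2 + 2 * x 4 ∧
  0 < 4 * x 0 - 2 * x 1 + x 3 ∧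
  0 < 8 * x 0 - 3 * x 1 - 2 * x 2 + x 4 ∧
  0 < -x 1 + 2 * x 3 + 3 * x 4 ∧
  0 < -x 0 + 2 * x 2 + 3 * x 3 + 2 * x 4 ∧
  0 < 13 * x 0 - 2 * x 1 - 3 * x 2 - 2 * x 3 ∧
  0 < -x 0 - x 1 + x 2 ∧
  0 < -x 0 - x 3 + x 4

/-- The union of the cone and its opposite. -/
def doubleCone : Set (Fin 5 → ℚ) := {x | InCone x ∨ InCone (-x)}

set_option maxHeartbeats 4000000 in
theorem InCone.reflMatrix_mulVec_pow {x : Fin 5 → ℚ} (hx : InCone x) {k : ℕ} (hk : 0 < k)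
    (hk' : k < 10) :
    InCone ((-1 : ℚ) ^ (k + 1) • (reflMatrix *ᵥ ((rotMatrix ^ k) *ᵥ x))) := by
  obtain ⟨h0, h1, h2, h3, h4, h5, h6, h7, h8, h9, h10, h11, h12, h13, h14, h15, h16, h17⟩ := hx
  interval_cases k <;>
  simp only [pow_one, rotMatrix_pow_2, rotMatrix_pow_3, rotMatrix_pow_4, rotMatrix_pow_5,
    rotMatrix_pow_6, rotMatrix_pow_7, rotMatrix_pow_8, rotMatrix_pow_9] <;>
  simp only [rotMatrix, reflMatrix, InCone, Pi.smul_apply, smul_eq_mul, mulVec, dotProduct,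
    Fin.sum_univ_five, of_apply, cons_val] <;>
  norm_num only <;>
  refine ⟨?_, ?_, ?_, ?_, ?_, ?_, ?_, ?_, ?_, ?_, ?_, ?_, ?_, ?_, ?_, ?_, ?_, ?_⟩ <;>
  linarith

theorem InCone.abs_lt {x : Fin 5 → ℚ} (hx : InCone x) {k : ℕ} (hk : 0 < k) (hk' : k < 10) :
    |x 0| < |((rotMatrix ^ k) *ᵥ x) 0| := by
  obtain ⟨h0, h1, h2, h3, h4, h5, h6, h7, h8, h9, h10, h11, h12, h13, h14, h15, h16, h17⟩ := hx
  have hpos : 0 < x 0 := by linarith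
  rw [abs_of_pos hpos, lt_abs]
  interval_cases k <;>
  simp only [pow_one, rotMatrix_pow_2, rotMatrix_pow_3, rotMatrix_pow_4, rotMatrix_pow_5,
    rotMatrix_pow_6, rotMatrix_pow_7, rotMatrix_pow_8, rotMatrix_pow_9] <;>
  simp only [rotMatrix, mulVec, dotProduct, Fin.sum_univ_five, of_apply, cons_val] <;>
  first
  | exact Or.inl (by linarith)
  | exact Or.inr (by linarith)

theorem reflMatrix_mulVec_pow_mem_doubleCone {x : Fin 5 → ℚ} (hx : x ∈ doubleCone) {k : ℕ}
    (hk : 0 < k) (hk' : k < 10) :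
    reflMatrix *ᵥ ((rotMatrix ^ k) *ᵥ x) ∈ doubleCone := by
  rcases hx with hx | hx <;> have h := hx.reflMatrix_mulVec_pow hk hk' <;>
    rcases neg_one_pow_eq_or ℚ (k + 1) with e | e <;>
    simp only [e, one_smul, neg_one_smul, mulVec_neg, neg_neg] at h
  exacts [Or.inl h, Or.inr h, Or.inr h, Or.inl h]

theorem abs_lt_of_mem_doubleCone {x : Fin 5 → ℚ} (hx : x ∈ doubleCone) {k : ℕ}
    (hk : 0 < k) (hk' : k < 10) : |x 0| < |((rotMatrix ^ k) *ᵥ x) 0| := by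
  rcases hx with hx | hx
  · exact hx.abs_lt hk hk'
  · simpa [mulVec_neg] using hx.abs_lt hk hk'

theorem rotMatrix_pow_mulVec_notMem_doubleCone {x : Fin 5 → ℚ} (hx : x ∈ doubleCone) {k : ℕ}
    (hk : 0 < k) (hk' : k < 10) : (rotMatrix ^ k) *ᵥ x ∉ doubleCone := by
  intro hy
  have h := abs_lt_of_mem_doubleCone hy (k := 10 - k) (by omega) (by omega)
  rw [mulVec_mulVec, ← pow_add, Nat.sub_add_cancel hk'.le, rotMatrix_pow_10, one_mulVec] at h
  exact (h.trans (abs_lt_of_mem_doubleCone hx hk hk')).false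

theorem doubleCone_nonempty : doubleCone.Nonempty := by
  refine ⟨![1, -1, 4, -3, 3], Or.inl ?_⟩
  simp only [InCone, cons_val]
  norm_num

theorem companionMatrix_eq (p : ℚ[X]) (a b c d e : ℚ)
    (hp : p = X ^ 5 + C e * X ^ 4 + C d * X ^ 3 + C c * X ^ 2 + C b * X + C a) :
    companionMatrix p =
      !![0, 0, 0, 0, -a; 1, 0, 0, 0, -b; 0, 1, 0, 0, -c; 0, 0, 1, 0, -d; 0, 0, 0, 1, -e] := by
  subst hp
  ext i j
  fin_cases i <;> fin_cases j <;>
    simp [companionMatrix, coeff_X, coeff_C, coeff_X_pow, coeff_C_mul]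

/-- `Γ(f,g) = ⟨T⟩ ∗ ⟨B⟩` for `f = ((X - 1) ^ 3 * (X ^ 2 - X + 1))`, `g = ((X + 1) * (X ^ 4 + X ^ 3 + X ^ 2 + X + 1))`. -/
theorem hypergeometric_free_product_case11 (A B T : GL (Fin 5) ℚ)
    (hA : (↑A : Matrix (Fin 5) (Fin 5) ℚ) = companionMatrix ((X - 1) ^ 3 * (X ^ 2 - X + 1)))
    (hB : (↑B : Matrix (Fin 5) (Fin 5) ℚ) = companionMatrix ((X + 1) * (X ^ 4 + X ^ 3 + X ^ 2 + X + 1)))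
    (hT : T = B * A⁻¹) :
    T ^ 2 = 1 ∧ T ≠ 1 ∧ orderOf B = 10 ∧ (∀ i : ℤ, B ^ i ≠ -1) ∧
    ∃ φ : Monoid.Coprod (Multiplicative (ZMod 2)) (Multiplicative (ZMod 10)) →* GL (Fin 5) ℚ,
      φ (Monoid.Coprod.inl (Multiplicative.ofAdd (1 : ZMod 2))) = T ∧
      φ (Monoid.Coprod.inr (Multiplicative.ofAdd (1 : ZMod 10))) = B ∧
      Function.Injective φ ∧
      φ.range = Subgroup.closure {A, B} := by
  have hAm : (A : Matrix (Fin 5) (Fin 5) ℚ) = unipMatrix := by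
    rw [hA, companionMatrix_eq _ (-1) 4 (-7) 7 (-4)
      (by simp only [map_neg, map_ofNat, map_one]; ring), unipMatrix]
    norm_num
  have hBm : (B : Matrix (Fin 5) (Fin 5) ℚ) = rotMatrix := by
    rw [hB, companionMatrix_eq _ 1 2 2 2 2 (by simp only [map_ofNat, map_one]; ring), rotMatrix]
  have hTA : T * A = B := by rw [hT, inv_mul_cancel_right]
  have hTm : (T : Matrix (Fin 5) (Fin 5) ℚ) = reflMatrix := by
    refine (Units.mul_left_inj A).mp ?_
    rw [← Units.val_mul, hTA, hAm, hBm, reflMatrix_mul_unipMatrix]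
  have hT2 : T ^ 2 = 1 :=
    Units.ext (by rw [Units.val_pow_eq_pow_val, hTm, reflMatrix_sq, Units.val_one])
  have hB10 : B ^ 10 = 1 :=
    Units.ext (by rw [Units.val_pow_eq_pow_val, hBm, rotMatrix_pow_10, Units.val_one])
  let := Matrix.GeneralLinearGroup.mulVecAction (Fin 5) ℚ
  have smul_T (x : Fin 5 → ℚ) : T • x = reflMatrix *ᵥ x := by rw [← hTm]; rfl
  have smul_B (k : ℕ) (x : Fin 5 → ℚ) : B ^ k • x = (rotMatrix ^ k) *ᵥ x := by
    rw [← hBm, ← Units.val_pow_eq_pow_val]; rfl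
  have hinj : Function.Injective
      (Monoid.Coprod.lift (zmodPowHom 2 T hT2) (zmodPowHom 10 B hB10)) := by
    refine Monoid.Coprod.lift_injective_of_ping_pong _ _ doubleCone doubleCone_nonempty ?_ ?_ ?_
    · have : Cardinal.mk (Multiplicative (ZMod 10)) = 10 := by
        simp [Cardinal.mk_fintype, ZMod.card]
      rw [this]
      norm_num
    · intro n hn
      obtain ⟨k, hk, hk', e⟩ := exists_zmodPowHom_eq_pow 10 B hB10 hn
      rw [e, Set.disjoint_left]
      rintro _ hy ⟨x, hx, rfl⟩
      refine rotMatrix_pow_mulVec_notMem_doubleCone hx hk hk' ?_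
      rwa [← smul_B]
    · intro m hm n hn
      obtain ⟨l, hl, hl', e'⟩ := exists_zmodPowHom_eq_pow 2 T hT2 hm
      obtain ⟨k, hk, hk', e⟩ := exists_zmodPowHom_eq_pow 10 B hB10 hn
      obtain rfl : l = 1 := by omega
      rw [e, e', pow_one]
      rintro _ ⟨_, ⟨x, hx, rfl⟩, rfl⟩
      simp only [smul_T, smul_B]
      exact reflMatrix_mulVec_pow_mem_doubleCone hx hk hk'
  refine ⟨hT2, ?_, ?_, ?_, Monoid.Coprod.lift (zmodPowHom 2 T hT2) (zmodPowHom 10 B hB10), ?_, ?_,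
    hinj, ?_⟩
  · intro h
    have h0 := congrFun₂ (hTm.symm.trans (congrArg Units.val h)) 0 0
    norm_num [reflMatrix] at h0
  · have hinr : Function.Injective (zmodPowHom 10 B hB10) := by
      rw [← Monoid.Coprod.lift_comp_inr (zmodPowHom 2 T hT2) (zmodPowHom 10 B hB10)]
      exact hinj.comp Monoid.Coprod.inr_injective
    have h := orderOf_injective _ hinr (Multiplicative.ofAdd 1)
    rwa [zmodPowHom_one, orderOf_ofAdd_eq_addOrderOf, ZMod.addOrderOf_one] at h
  · intro i h
    obtain ⟨k, hk⟩ := Int.eq_ofNat_of_zero_le (Int.emod_nonneg i (by norm_num : (10 : ℤ) ≠ 0))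
    have hBk : B ^ k = -1 := by
      have h10 : B ^ (10 : ℤ) = 1 := mod_cast hB10
      rw [← h, ← Int.emod_add_mul_ediv i 10, _root_.zpow_add, _root_.zpow_mul, h10,
        _root_.one_zpow, mul_one, hk, _root_.zpow_natCast]
    have hk' : k < 10 := by omega
    have hm : rotMatrix ^ k = -1 := by
      rw [← hBm, ← Units.val_pow_eq_pow_val, hBk, Units.val_neg, Units.val_one]
    rcases Nat.eq_zero_or_pos k with rfl | hk₀
    · have h0 := congrFun₂ hm 0 0
      norm_num at h0
    · obtain ⟨x, hx⟩ := doubleCone_nonempty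
      refine rotMatrix_pow_mulVec_notMem_doubleCone hx hk₀ hk' ?_
      rw [hm, neg_mulVec, one_mulVec]
      rcases hx with hx | hx
      exacts [Or.inr (by rwa [neg_neg]), Or.inl hx]
  · simp [zmodPowHom_one]
  · simp [zmodPowHom_one]
  · rw [Monoid.Coprod.range_lift, zmodPowHom_range, zmodPowHom_range]
    refine le_antisymm (sup_le ?_ ?_) ((Subgroup.closure_le _).mpr ?_)
    · rw [Subgroup.zpowers_le, hT]
      exact mul_mem (Subgroup.subset_closure (by simp))
        (inv_mem (Subgroup.subset_closure (by simp)))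
    · rw [Subgroup.zpowers_le]
      exact Subgroup.subset_closure (by simp)
    · have hTmem : T ∈ Subgroup.zpowers T ⊔ Subgroup.zpowers B :=
        le_sup_left (a := Subgroup.zpowers T) (Subgroup.mem_zpowers T)
      have hBmem : B ∈ Subgroup.zpowers T ⊔ Subgroup.zpowers B :=
        le_sup_right (a := Subgroup.zpowers T) (Subgroup.mem_zpowers B)
      refine Set.insert_subset ?_ (Set.singleton_subset_iff.mpr hBmem)
      rw [SetLike.mem_coe, ← inv_mul_cancel_left T A, hTA]
      exact mul_mem (inv_mem hTmem) hBmem
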